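/- arXiv:1012.2416 — 3 statements merged into one kernel-verified Lean document; each statement's English description precedes it below -/
import Mathlib

section
/- Let T and T' be pretriangulated categories and let 𝓛 be a class of objects of T such that every object of T belongs to 𝓛^{*n} for some n ≥ 0. Let f, g : T ⥤ T' be triangulated (exact) functors and let ε : f ⟶ g be a natural transformation which commutes with the shift functors (compatible with the commutation isomorphisms of f and g with the shifts, so that ε is a morphism of triangulated functors). If the component ε_L : f.obj L ⟶ g.obj L is an isomorphism for every L in 𝓛, then ε_X is an isomorphism for every object X of T, i.e., ε is a natural isomorphism. -/
open CategoryTheory CategoryTheory.Limits CategoryTheory.Pretriangulated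

variable {T : Type*} [Category T] [HasZeroObject T] [HasShift T ℤ] [Preadditive T]
  [∀ n : ℤ, (shiftFunctor T n).Additive] [Pretriangulated T]

/-- The operation `𝓐 * 𝓑` on classes of objects of a pretriangulated category: the class of
objects `Y` fitting in a distinguished triangle `X ⟶ Y ⟶ Z ⟶ X⟦1⟧` with `X` isomorphic to an
object of `𝓐` and `Z` belonging to `𝓑`. -/
def setStar (S₁ S₂ : Set T) : Set T :=
  {Y | ∃ (X Z : T) (u : X ⟶ Y) (v : Y ⟶ Z) (w : Z ⟶ X⟦(1 : ℤ)⟧),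
    (Triangle.mk u v w ∈ distTriang T) ∧ (∃ X' ∈ S₁, Nonempty (X ≅ X')) ∧ Z ∈ S₂}

/-- The iterated star operation: `𝓛^{*0}` is the class of zero objects and
`𝓛^{*(i+1)} = 𝓛 * 𝓛^{*i}`. -/
def setStarPower (L : Set T) : ℕ → Set T
  | 0 => {X | IsZero X}
  | (n + 1) => setStar L (setStarPower L n)

/-- The morphism of triangles induced by a natural transformation commuting with the shifts. -/
def natTransMapTriangleHom {T' : Type*} [Category T'] [HasShift T' ℤ] {f g : T ⥤ T'}
    [f.CommShift ℤ] [g.CommShift ℤ] (ε : f ⟶ g) [NatTrans.CommShift ε ℤ] (A : Triangle T) :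
    f.mapTriangle.obj A ⟶ g.mapTriangle.obj A where
  hom₁ := ε.app A.obj₁
  hom₂ := ε.app A.obj₂
  hom₃ := ε.app A.obj₃
  comm₁ := ε.naturality A.mor₁
  comm₂ := ε.naturality A.mor₂
  comm₃ := by
    have h : (f.map A.mor₃ ≫ (f.commShiftIso (1 : ℤ)).hom.app A.obj₁) ≫ (ε.app A.obj₁)⟦(1 : ℤ)⟧' =
        ε.app A.obj₃ ≫ g.map A.mor₃ ≫ (g.commShiftIso (1 : ℤ)).hom.app A.obj₁ := by
      rw [Category.assoc, NatTrans.shift_app_comm, NatTrans.naturality_assoc]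
    exact h

/-- If a natural transformation of triangulated functors commutes with the shifts and is an
isomorphism on the outer terms of a distinguished triangle, it is one on the middle term. -/
theorem natTrans_isIso_app_obj₂ {T' : Type*} [Category T'] [HasZeroObject T'] [HasShift T' ℤ]
    [Preadditive T'] [∀ n : ℤ, (shiftFunctor T' n).Additive] [Pretriangulated T']
    {f g : T ⥤ T'} [f.CommShift ℤ] [g.CommShift ℤ] [f.IsTriangulated] [g.IsTriangulated]
    (ε : f ⟶ g) [NatTrans.CommShift ε ℤ] {A : Triangle T} (hA : A ∈ distTriang T)
    (h₁ : IsIso (ε.app A.obj₁)) (h₃ : IsIso (ε.app A.obj₃)) : IsIso (ε.app A.obj₂) :=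
  isIso₂_of_isIso₁₃ (natTransMapTriangleHom ε A) (f.map_distinguished A hA)
    (g.map_distinguished A hA) h₁ h₃

/-- dévissage.  Let `T`, `T'` be pretriangulated categories and `𝓛` a class of
objects of `T` such that every object of `T` lies in `𝓛^{*n}` for some `n`.  Let `f, g : T ⥤ T'`
be triangulated functors and `ε : f ⟶ g` a natural transformation commuting with the shifts.
If `ε_L` is an isomorphism for every `L ∈ 𝓛`, then `ε_X` is an isomorphism for every `X`. -/
theorem natTrans_isIso_of_isIso_on_generators
    {T' : Type*} [Category T'] [HasZeroObject T'] [HasShift T' ℤ] [Preadditive T']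
    [∀ n : ℤ, (shiftFunctor T' n).Additive] [Pretriangulated T']
    (f g : T ⥤ T') [f.CommShift ℤ] [g.CommShift ℤ]
    [f.IsTriangulated] [g.IsTriangulated]
    (ε : f ⟶ g) [NatTrans.CommShift ε ℤ]
    (L : Set T) (hL : ∀ X : T, ∃ n : ℕ, X ∈ setStarPower L n)
    (hiso : ∀ X ∈ L, IsIso (ε.app X)) :
    ∀ X : T, IsIso (ε.app X) := by
  intro X
  obtain ⟨n, hn⟩ := hL X
  induction n generalizing X with
  | zero =>
    have hX : IsZero X := hn
    exact ⟨0, (f.map_isZero hX).eq_of_src _ _, (g.map_isZero hX).eq_of_src _ _⟩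
  | succ n ih =>
    obtain ⟨Y, Z, u, v, w, hT, ⟨Y', hY', ⟨e⟩⟩, hZ⟩ := hn
    exact natTrans_isIso_app_obj₂ ε hT
      ((NatTrans.isIso_app_iff_of_iso ε e).2 (hiso Y' hY')) (ih Z hZ)
end

section
/- Let A be a finite-dimensional ℂ-algebra equipped with a ℤ-grading 𝒜 : ℤ → Submodule ℂ A making A a graded algebra (A = ⊕_i 𝒜_i with 𝒜_i · 𝒜_j ⊆ 𝒜_{i+j} and 1 ∈ 𝒜_0). Let M be a finite-dimensional right A-module which is indecomposable (M ≠ 0, and whenever M is the internal direct sum of two submodules N and P, one of N, P is zero). Suppose ℳ, ℳ' : ℤ → Submodule ℂ M are two gradings of M compatible with the grading of A (M = ⊕_i ℳ_i with ℳ_i · 𝒜_j ⊆ ℳ_{i+j}, and likewise for ℳ'). Then there exist an integer n and an A-module automorphism e of M such that e(ℳ_i) = ℳ'_{i+n} for every i ∈ ℤ; that is, any two lifts of the indecomposable module M to a graded module are isomorphic up to a shift of the grading. -/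
open scoped DirectSum

/-- Over a Noetherian and Artinian indecomposable module every endomorphism is a unit or
nilpotent (Fitting). -/
theorem Module.End.isUnit_or_isNilpotent_of_indecomposable {R M : Type*} [Ring R]
    [AddCommGroup M] [Module R M] [IsNoetherian R M] [IsArtinian R M]
    (hind : ∀ N P : Submodule R M, N ⊓ P = ⊥ → N ⊔ P = ⊤ → N = ⊥ ∨ P = ⊥)
    (f : Module.End R M) : IsUnit f ∨ IsNilpotent f := by
  obtain ⟨n, hn, h⟩ := ((Filter.eventually_ge_atTop 1).and
    (LinearMap.eventually_isCompl_ker_pow_range_pow f)).exists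
  rcases hind _ _ h.inf_eq_bot h.sup_eq_top with h' | h'
  · left
    have hinj : Function.Injective (f ^ n) := LinearMap.ker_eq_bot.1 h'
    have hu : IsUnit (f ^ n) :=
      (Module.End.isUnit_iff _).2 (IsArtinian.bijective_of_injective_endomorphism _ hinj)
    exact (isUnit_pow_iff (by omega)).1 hu
  · exact Or.inr ⟨n, LinearMap.range_eq_bot.1 h'⟩

/-- If every element of a ring is a unit or nilpotent, then a finite sum which is a unit has a
unit among its terms, unless the ring is trivial. -/
theorem exists_isUnit_of_isUnit_sum {E ι : Type*} [Ring E] [Nontrivial E]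
    (hE : ∀ x : E, IsUnit x ∨ IsNilpotent x) (s : Finset ι) (f : ι → E)
    (h : IsUnit (∑ i ∈ s, f i)) : ∃ i ∈ s, IsUnit (f i) := by
  classical
  induction s using Finset.induction_on with
  | empty => simp at h
  | insert a s ha ih =>
    rw [Finset.sum_insert ha] at h
    obtain ⟨u, hu⟩ := h
    rcases hE (↑u⁻¹ * f a) with h1 | h1
    · exact ⟨a, by simp, (Units.isUnit_units_mul _ _).1 h1⟩
    · have h2 : ↑u⁻¹ * ∑ i ∈ s, f i = 1 - ↑u⁻¹ * f a := by
        rw [eq_sub_iff_add_eq', ← mul_add, ← hu, Units.inv_mul]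
      have h3 := h1.isUnit_one_sub
      rw [← h2, Units.isUnit_units_mul] at h3
      obtain ⟨i, hi, h4⟩ := ih h3
      exact ⟨i, by simp [hi], h4⟩

/-- The family of projections attached to an internal direct sum decomposition. -/
theorem DirectSum.IsInternal.exists_projections {ι K M : Type*} [DecidableEq ι] [Ring K]
    [AddCommGroup M] [Module K M] {ℳ : ι → Submodule K M} (h : DirectSum.IsInternal ℳ) :
    ∃ p : ι → M →ₗ[K] M, (∀ i x, p i x ∈ ℳ i) ∧ (∀ i, ∀ x ∈ ℳ i, p i x = x) ∧
      ∀ i j, j ≠ i → ∀ x ∈ ℳ j, p i x = 0 := by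
  let := h.chooseDecomposition
  refine ⟨fun i => (ℳ i).subtype ∘ₗ DirectSum.component K ι (fun i => ℳ i) i ∘ₗ
    (DirectSum.decomposeLinearEquiv ℳ).toLinearMap, fun i x => Subtype.property _,
    fun i x hx => DirectSum.decompose_of_mem_same ℳ hx,
    fun i j hij x hx => DirectSum.decompose_of_mem_ne ℳ hx hij⟩

/-- An additive predicate holding on all summands of an internal decomposition holds
everywhere. -/
theorem DirectSum.IsInternal.induction {ι K M : Type*} [DecidableEq ι] [Ring K]
    [AddCommGroup M] [Module K M] {ℳ : ι → Submodule K M} (h : DirectSum.IsInternal ℳ)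
    {motive : M → Prop} (mem : ∀ i, ∀ x ∈ ℳ i, motive x) (zero : motive 0)
    (add : ∀ x y, motive x → motive y → motive (x + y)) (x : M) : motive x :=
  Submodule.iSup_induction ℳ (motive := motive) (by simp [h.submodule_iSup_eq_top]) mem zero add

/-- two graded lifts of a finite-dimensional indecomposable right module
over a finite-dimensional graded `ℂ`-algebra are isomorphic up to a shift of the grading:
there exist `n : ℤ` and a module automorphism `e` of `M` with `e (ℳ i) = ℳ' (i + n)` for
all `i`. -/
theorem graded_lifts_iso_up_to_shift
    (A : Type*) [Ring A] [Algebra ℂ A] [FiniteDimensional ℂ A]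
    (𝒜 : ℤ → Submodule ℂ A)
    (h𝒜 : DirectSum.IsInternal 𝒜)
    (h𝒜mul : ∀ i j : ℤ, ∀ a ∈ 𝒜 i, ∀ b ∈ 𝒜 j, a * b ∈ 𝒜 (i + j))
    (h𝒜one : (1 : A) ∈ 𝒜 0)
    (M : Type*) [AddCommGroup M] [Module Aᵐᵒᵖ M] [Module ℂ M]
    [IsScalarTower ℂ Aᵐᵒᵖ M] [FiniteDimensional ℂ M]
    -- `M` is indecomposable:
    (hM : (⊤ : Submodule Aᵐᵒᵖ M) ≠ ⊥)
    (hind : ∀ N P : Submodule Aᵐᵒᵖ M, N ⊓ P = ⊥ → N ⊔ P = ⊤ → N = ⊥ ∨ P = ⊥)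
    -- two gradings of `M` compatible with the grading of `A`:
    (ℳ ℳ' : ℤ → Submodule ℂ M)
    (hℳ : DirectSum.IsInternal ℳ)
    (hℳmul : ∀ i j : ℤ, ∀ m ∈ ℳ i, ∀ a ∈ 𝒜 j, (MulOpposite.op a) • m ∈ ℳ (i + j))
    (hℳ' : DirectSum.IsInternal ℳ')
    (hℳ'mul : ∀ i j : ℤ, ∀ m ∈ ℳ' i, ∀ a ∈ 𝒜 j, (MulOpposite.op a) • m ∈ ℳ' (i + j)) :
    ∃ (n : ℤ) (e : M ≃ₗ[Aᵐᵒᵖ] M), ∀ i : ℤ, e '' (ℳ i : Set M) = (ℳ' (i + n) : Set M) := by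
  classical
  have : IsNoetherian Aᵐᵒᵖ M := isNoetherian_of_tower ℂ inferInstance
  have : IsArtinian Aᵐᵒᵖ M := isArtinian_of_tower ℂ inferInstance
  have : Nontrivial M := by
    by_contra hn
    rw [not_nontrivial_iff_subsingleton] at hn
    exact hM (Subsingleton.elim _ _)
  obtain ⟨p, hp, hp_same, hp_ne⟩ := hℳ.exists_projections
  obtain ⟨p', hp', hp'_same, hp'_ne⟩ := hℳ'.exists_projections
  have hfin := WellFoundedGT.finite_ne_bot_of_iSupIndep hℳ.submodule_iSupIndep
  have hfin' := WellFoundedGT.finite_ne_bot_of_iSupIndep hℳ'.submodule_iSupIndep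
  set S := hfin.toFinset with hS
  set S' := hfin'.toFinset with hS'
  have hp'_smul : ∀ k j, ∀ a ∈ 𝒜 j, ∀ m,
      p' (k + j) (MulOpposite.op a • m) = MulOpposite.op a • p' k m := by
    intro k j a ha m
    induction m using hℳ'.induction with
    | mem i x hx =>
      by_cases hik : i = k
      · subst hik
        rw [hp'_same _ _ hx, hp'_same _ _ (hℳ'mul _ _ _ hx _ ha)]
      · rw [hp'_ne _ _ hik _ hx, hp'_ne _ _ (by omega) _ (hℳ'mul _ _ _ hx _ ha), smul_zero]
    | zero => simp
    | add x y hx hy => simp only [smul_add, map_add, hx, hy]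
  let g : ℤ → M →ₗ[ℂ] M := fun n => ∑ i ∈ S, p' (i + n) ∘ₗ p i
  have hg : ∀ n i, ∀ x ∈ ℳ i, g n x = p' (i + n) x := by
    intro n i x hx
    simp only [g, LinearMap.sum_apply, LinearMap.comp_apply]
    rw [Finset.sum_eq_single i, hp_same i x hx]
    · intro j _ hj
      rw [hp_ne j i hj.symm x hx, map_zero]
    · intro hi
      have : ℳ i = ⊥ := by simpa [hS] using hi
      rw [this, Submodule.mem_bot] at hx
      simp [hx]
  have hg_smul : ∀ n (r : Aᵐᵒᵖ) m, g n (r • m) = r • g n m := by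
    intro n r m
    induction r using MulOpposite.rec' with | _ a
    induction a using h𝒜.induction with
    | zero => simp
    | add a b ha hb => simp only [MulOpposite.op_add, add_smul, map_add, ha, hb]
    | mem j a ha =>
      induction m using hℳ.induction with
      | zero => simp
      | add x y hx hy => simp only [smul_add, map_add, hx, hy]
      | mem i x hx =>
        rw [hg n i x hx, hg n (i + j) _ (hℳmul _ _ _ hx _ ha), ← hp'_smul _ _ _ ha,
          add_right_comm]
  let f : ℤ → Module.End Aᵐᵒᵖ M := fun n =>
    { toFun := g n, map_add' := map_add (g n), map_smul' := hg_smul n }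
  have hp'_sum : ∀ x, ∑ j ∈ S', p' j x = x := by
    intro x
    induction x using hℳ'.induction with
    | zero => simp
    | add x y hx hy => simp only [map_add, Finset.sum_add_distrib, hx, hy]
    | mem i x hx =>
      rw [Finset.sum_eq_single i, hp'_same i x hx]
      · intro j _ hj
        exact hp'_ne j i hj.symm x hx
      · intro hi
        have : ℳ' i = ⊥ := by simpa [hS'] using hi
        rw [this, Submodule.mem_bot] at hx
        simp [hx]
  let T : Finset ℤ := (S' ×ˢ S).image fun q => q.1 - q.2
  have hsum : ∑ n ∈ T, f n = 1 := by
    ext x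
    rw [LinearMap.sum_apply, Module.End.one_apply]
    change ∑ n ∈ T, g n x = x
    induction x using hℳ.induction with
    | zero => simp
    | add x y hx hy => simp only [map_add, Finset.sum_add_distrib, hx, hy]
    | mem i x hx =>
      by_cases hi : ℳ i = ⊥
      · rw [hi, Submodule.mem_bot] at hx
        simp [hx]
      have hiS : i ∈ S := by simpa [hS] using hi
      conv_rhs => rw [← hp'_sum x]
      rw [Finset.sum_congr rfl fun n _ => hg n i x hx]
      symm
      rw [← Finset.sum_image (s := T) (g := fun n => i + n) (f := fun j => p' j x)
        (fun a _ b _ h => add_left_cancel h)]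
      refine Finset.sum_subset ?_ ?_
      · intro j hj
        exact Finset.mem_image.2 ⟨j - i, Finset.mem_image.2 ⟨(j, i),
          Finset.mem_product.2 ⟨hj, hiS⟩, rfl⟩, by ring⟩
      · intro j _ hj
        have hj' : ℳ' j = ⊥ := by simpa [hS'] using hj
        have := hp' j x
        rwa [hj', Submodule.mem_bot] at this
  obtain ⟨n, -, hn⟩ := exists_isUnit_of_isUnit_sum
    (Module.End.isUnit_or_isNilpotent_of_indecomposable hind) T f (hsum ▸ isUnit_one)
  rw [Module.End.isUnit_iff] at hn
  have hf_mem : ∀ i, ∀ x ∈ ℳ i, f n x ∈ ℳ' (i + n) := fun i x hx => by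
    change g n x ∈ _
    rw [hg n i x hx]
    exact hp' _ _
  have hf_comm : ∀ i x, f n (p i x) = p' (i + n) (f n x) := by
    intro i x
    induction x using hℳ.induction with
    | zero => simp
    | add x y hx hy => simp only [map_add, hx, hy]
    | mem j x hx =>
      by_cases hji : j = i
      · subst hji
        rw [hp_same _ _ hx, hp'_same _ _ (hf_mem _ _ hx)]
      · rw [hp_ne _ _ hji _ hx, hp'_ne _ _ (by omega) _ (hf_mem _ _ hx), map_zero]
  refine ⟨n, LinearEquiv.ofBijective (f n) hn, fun i => Set.Subset.antisymm ?_ ?_⟩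
  · rintro _ ⟨x, hx, rfl⟩
    exact hf_mem i x hx
  · intro y hy
    obtain ⟨x, rfl⟩ := hn.2 y
    refine ⟨p i x, hp i x, ?_⟩
    change f n (p i x) = f n x
    rw [hf_comm, hp'_same _ _ hy]
end

section
/- Let A be a finite-dimensional ℂ-algebra equipped with a ℤ-grading 𝒜 : ℤ → Submodule ℂ A making A a graded algebra. Let P be a finite-dimensional right A-module which is an indecomposable projective A-module, and let 𝒫 : ℤ → Submodule ℂ P be a grading of P compatible with 𝒜. Then this graded lift of P is projective in the graded category: for every finite-dimensional right A-module N with a compatible grading 𝒩 : ℤ → Submodule ℂ N, and every surjective A-linear map f : N → P which is homogeneous of degree 0 (f(𝒩_i) ⊆ 𝒫_i for all i), there exists an A-linear map g : P → N homogeneous of degree 0 (g(𝒫_i) ⊆ 𝒩_i for all i) with f ∘ g = id_P. -/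
open MulOpposite in
/-- For a grading of a right module, taking homogeneous components intertwines the action of a
homogeneous ring element of degree `j` with a shift of the degree by `j`. -/
theorem decompose_op_smul_add {R A M : Type*} [Semiring R] [Semiring A] [AddCommMonoid M]
    [Module Aᵐᵒᵖ M] [Module R M] (𝒜 : ℤ → Set A) (ℳ : ℤ → Submodule R M)
    [DirectSum.Decomposition ℳ]
    (hmul : ∀ i j : ℤ, ∀ m ∈ ℳ i, ∀ a ∈ 𝒜 j, op a • m ∈ ℳ (i + j))
    (i j : ℤ) {a : A} (ha : a ∈ 𝒜 j) (m : M) :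
    (DirectSum.decompose ℳ (op a • m) (i + j) : M) = op a • (DirectSum.decompose ℳ m i : M) := by
  induction m using DirectSum.Decomposition.inductionOn ℳ with
  | zero => simp
  | @homogeneous k m =>
    have h := hmul k j m m.2 a ha
    by_cases hk : k = i
    · subst hk
      rw [DirectSum.decompose_of_mem_same _ h, DirectSum.decompose_of_mem_same _ m.2]
    · rw [DirectSum.decompose_of_mem_ne _ h (by omega), DirectSum.decompose_of_mem_ne _ m.2 hk,
        smul_zero]
  | add m m' hm hm' => simp [DirectSum.decompose_add, smul_add, hm, hm']

/-- The degree-zero part of a linear map between graded modules: the linear map which sends a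
homogeneous element `x` of degree `i` to the degree `i` component of its image. -/
theorem exists_degree_zero_part {R M N : Type*} [Semiring R] [AddCommMonoid M] [AddCommMonoid N]
    [Module R M] [Module R N] (ℳ : ℤ → Submodule R M) (𝒩 : ℤ → Submodule R N)
    [DirectSum.Decomposition ℳ] [DirectSum.Decomposition 𝒩] (s : M →ₗ[R] N) :
    ∃ g : M →ₗ[R] N, ∀ i, ∀ x ∈ ℳ i, g x = (DirectSum.decompose 𝒩 (s x) i : N) := by
  refine ⟨(DirectSum.toModule R ℤ N fun i =>
      (𝒩 i).subtype ∘ₗ DirectSum.component R ℤ (fun i => 𝒩 i) i ∘ₗ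
        (DirectSum.decomposeLinearEquiv 𝒩).toLinearMap ∘ₗ s ∘ₗ (ℳ i).subtype) ∘ₗ
      (DirectSum.decomposeLinearEquiv ℳ).toLinearMap, fun i x hx => ?_⟩
  have h : DirectSum.decomposeLinearEquiv ℳ x = DirectSum.lof R ℤ (fun i => ℳ i) i ⟨x, hx⟩ :=
    DirectSum.decompose_of_mem ℳ hx
  simp only [LinearMap.comp_apply, LinearEquiv.coe_coe, h, DirectSum.toModule_lof]
  rfl

/-- a graded lift of a finite-dimensional indecomposable projective right module
over a finite-dimensional graded `ℂ`-algebra is projective in the graded category: every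
degree-zero surjection from a graded finite-dimensional module onto it admits a degree-zero
section. -/
theorem graded_lift_of_projective_is_graded_projective
    (A : Type*) [Ring A] [Algebra ℂ A] [FiniteDimensional ℂ A]
    (𝒜 : ℤ → Submodule ℂ A)
    (h𝒜 : DirectSum.IsInternal 𝒜)
    (h𝒜mul : ∀ i j : ℤ, ∀ a ∈ 𝒜 i, ∀ b ∈ 𝒜 j, a * b ∈ 𝒜 (i + j))
    (h𝒜one : (1 : A) ∈ 𝒜 0)
    (P : Type*) [AddCommGroup P] [Module Aᵐᵒᵖ P] [Module ℂ P]
    [IsScalarTower ℂ Aᵐᵒᵖ P] [FiniteDimensional ℂ P]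
    -- `P` is an indecomposable projective `A`-module:
    (hP : (⊤ : Submodule Aᵐᵒᵖ P) ≠ ⊥)
    (hind : ∀ N₁ N₂ : Submodule Aᵐᵒᵖ P, N₁ ⊓ N₂ = ⊥ → N₁ ⊔ N₂ = ⊤ → N₁ = ⊥ ∨ N₂ = ⊥)
    (hproj : Module.Projective Aᵐᵒᵖ P)
    -- a grading of `P` compatible with the grading of `A`:
    (ℙ𝕘 : ℤ → Submodule ℂ P)
    (hℙ𝕘 : DirectSum.IsInternal ℙ𝕘)
    (hℙ𝕘mul : ∀ i j : ℤ, ∀ m ∈ ℙ𝕘 i, ∀ a ∈ 𝒜 j, (MulOpposite.op a) • m ∈ ℙ𝕘 (i + j)) :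
    -- conclusion: graded projectivity
    ∀ (N : Type) [AddCommGroup N] [Module Aᵐᵒᵖ N] [Module ℂ N]
      [IsScalarTower ℂ Aᵐᵒᵖ N] [FiniteDimensional ℂ N]
      (𝒩 : ℤ → Submodule ℂ N),
      DirectSum.IsInternal 𝒩 →
      (∀ i j : ℤ, ∀ m ∈ 𝒩 i, ∀ a ∈ 𝒜 j, (MulOpposite.op a) • m ∈ 𝒩 (i + j)) →
      ∀ f : N →ₗ[Aᵐᵒᵖ] P, Function.Surjective f →
        (∀ i : ℤ, ∀ x ∈ 𝒩 i, f x ∈ ℙ𝕘 i) →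
        ∃ g : P →ₗ[Aᵐᵒᵖ] N,
          (∀ i : ℤ, ∀ x ∈ ℙ𝕘 i, g x ∈ 𝒩 i) ∧ f.comp g = LinearMap.id := by
  intro N _ _ _ _ _ 𝒩 h𝒩 h𝒩mul f hf hfdeg
  let _ := h𝒜.chooseDecomposition
  let _ := hℙ𝕘.chooseDecomposition
  let _ := h𝒩.chooseDecomposition
  obtain ⟨s, hs⟩ := Module.projective_lifting_property f LinearMap.id hf
  obtain ⟨g, hg⟩ := exists_degree_zero_part ℙ𝕘 𝒩 (s.restrictScalars ℂ)
  have hgsmul : ∀ (a : A) (x : P), g (MulOpposite.op a • x) = MulOpposite.op a • g x := by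
    intro a x
    induction x using DirectSum.Decomposition.inductionOn ℙ𝕘 with
    | zero => simp
    | add x y hx hy => simp only [smul_add, map_add, hx, hy]
    | @homogeneous i x =>
      induction a using DirectSum.Decomposition.inductionOn 𝒜 with
      | zero => simp
      | add a b ha hb => simp only [MulOpposite.op_add, add_smul, map_add, ha, hb]
      | @homogeneous j a =>
        rw [hg _ _ (hℙ𝕘mul i j x x.2 a a.2), hg i x x.2, LinearMap.restrictScalars_apply,
          LinearMap.restrictScalars_apply, map_smul]
        exact decompose_op_smul_add (fun j => (𝒜 j : Set A)) 𝒩 h𝒩mul i j a.2 (s x)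
  have hfdec : ∀ i n, f (DirectSum.decompose 𝒩 n i) = (DirectSum.decompose ℙ𝕘 (f n) i : P) := by
    intro i n
    induction n using DirectSum.Decomposition.inductionOn 𝒩 with
    | zero => simp
    | add x y hx hy => simp [DirectSum.decompose_add, hx, hy]
    | @homogeneous k n =>
      have h := hfdeg k n n.2
      by_cases hk : k = i
      · subst hk
        rw [DirectSum.decompose_of_mem_same _ h, DirectSum.decompose_of_mem_same _ n.2]
      · rw [DirectSum.decompose_of_mem_ne _ h hk, DirectSum.decompose_of_mem_ne _ n.2 hk, map_zero]
  refine ⟨{ g with map_smul' := fun a x => hgsmul a.unop x }, fun i x hx => ?_, ?_⟩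
  · change g x ∈ 𝒩 i
    rw [hg i x hx]
    exact SetLike.coe_mem _
  · ext x
    change f (g x) = x
    induction x using DirectSum.Decomposition.inductionOn ℙ𝕘 with
    | zero => simp
    | add x y hx hy => simp only [map_add, hx, hy]
    | @homogeneous i x =>
      have hsx : f (s x) = x := LinearMap.congr_fun hs x
      rw [hg i x x.2, hfdec, LinearMap.restrictScalars_apply, hsx,
        DirectSum.decompose_of_mem_same _ x.2]
end
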